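/- arXiv:1809.05083 — 2 statements merged into one kernel-verified Lean document; each statement's English description precedes it below -/
import Mathlib

section
/- Let R be a set of rewrite rules on binary trees such that every tree appearing as a member of a rule of R has degree at most d, where d ≥ 1. Assume that the induced rewrite relation ⇒ is terminating, and that for every binary tree t of degree at most 2d − 1 and all binary trees s_1 ≠ s_2 with t ⇒ s_1 and t ⇒ s_2, there exists a binary tree t' with s_1 ⇒* t' and s_2 ⇒* t'. Then ⇒ is confluent. -/
/-- A binary tree: either a leaf or an ordered pair of binary trees. -/
inductive BTree : Type
  | leaf : BTree
  | node : BTree → BTree → BTree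
  deriving DecidableEq

namespace BTree

/-- The arity of a binary tree is its number of leaves. -/
def arity : BTree → ℕ
  | leaf => 1
  | node l r => arity l + arity r

/-- The degree of a binary tree is its number of internal nodes. -/
def degree : BTree → ℕ
  | leaf => 0
  | node l r => degree l + degree r + 1

/-- Grafting `t ∘ᵢ s`: identify the root of `s` with the `i`-th leaf of `t`
(leaves numbered from left to right, starting at `1`). -/
def graft : BTree → ℕ → BTree → BTree
  | leaf, i, s => if i = 1 then s else leaf
  | node l r, i, s =>
      if i ≤ l.arity then node (l.graft i s) r else node l (r.graft (i - l.arity) s)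

/-- Simultaneous grafting `s ∘ [r_1, …, r_n]`: graft the `i`-th element of the
list onto the `i`-th leaf of `s`, simultaneously. -/
def multigraft : BTree → List BTree → BTree
  | leaf, rs => rs.headD leaf
  | node l r, rs => node (l.multigraft (rs.take l.arity)) (r.multigraft (rs.drop l.arity))

/-- The left comb with `γ` internal nodes. -/
def leftComb : ℕ → BTree
  | 0 => leaf
  | γ + 1 => node (leftComb γ) leaf

/-- The right comb with `γ` internal nodes. -/
def rightComb : ℕ → BTree
  | 0 => leaf
  | γ + 1 => node leaf (rightComb γ)

/-- The prefix word of a binary tree, over the alphabet `{0, 2}`: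
a left-to-right depth-first traversal writes `2` for each internal node and
`0` for each leaf. -/
def prefixWord : BTree → List ℕ
  | leaf => [0]
  | node l r => 2 :: (prefixWord l ++ prefixWord r)

/-- The left rank: number of internal nodes on the leftmost branch from the root. -/
def leftRank : BTree → ℕ
  | leaf => 0
  | node l _ => leftRank l + 1

/-- The mirror of a binary tree. -/
def mirror : BTree → BTree
  | leaf => leaf
  | node l r => node (mirror r) (mirror l)

end BTree

/-- One step of the rewrite relation induced by a set of rewrite rules `R`:
`r ∘ᵢ (s ∘ [r_1, …, r_n]) ⇒ r ∘ᵢ (s' ∘ [r_1, …, r_n])` whenever `R s s'`. -/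
def Step (R : BTree → BTree → Prop) (t t' : BTree) : Prop :=
  ∃ (s s' r : BTree) (i : ℕ) (rs : List BTree),
    R s s' ∧ 1 ≤ i ∧ i ≤ r.arity ∧ rs.length = s.arity ∧
    t = r.graft i (s.multigraft rs) ∧ t' = r.graft i (s'.multigraft rs)

/-- The congruence generated by a set of rewrite rules: the reflexive–symmetric–transitive
closure of the induced rewrite relation. -/
def CongrGen (R : BTree → BTree → Prop) : BTree → BTree → Prop :=
  Relation.EqvGen (Step R)

/-- The tree `s` occurs as a subtree of `t`. -/
def Occurs (s t : BTree) : Prop :=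
  ∃ (r : BTree) (i : ℕ) (rs : List BTree),
    1 ≤ i ∧ i ≤ r.arity ∧ rs.length = s.arity ∧ t = r.graft i (s.multigraft rs)

/-- The rewrite relation induced by `R` is terminating: there is no infinite
chain `t_0 ⇒ t_1 ⇒ t_2 ⇒ ⋯`. -/
def Terminating (R : BTree → BTree → Prop) : Prop :=
  ¬ ∃ f : ℕ → BTree, ∀ n, Step R (f n) (f (n + 1))

/-- The rewrite relation induced by `R` is confluent. -/
def Confluent (R : BTree → BTree → Prop) : Prop :=
  ∀ t s₁ s₂, Relation.ReflTransGen (Step R) t s₁ → Relation.ReflTransGen (Step R) t s₂ →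
    ∃ t', Relation.ReflTransGen (Step R) s₁ t' ∧ Relation.ReflTransGen (Step R) s₂ t'

/-- The number of equivalence classes of binary trees of arity `n` under the
equivalence relation `E`. -/
noncomputable def classCount (E : BTree → BTree → Prop) (n : ℕ) : ℕ :=
  Nat.card (Quot fun a b : {t : BTree // t.arity = n} => E a.1 b.1)

/-- The congruence `≡_γ` generated by the single rewrite rule `(L_γ, R_γ)`. -/
def CAsCongr (γ : ℕ) : BTree → BTree → Prop :=
  CongrGen fun s s' => s = BTree.leftComb γ ∧ s' = BTree.rightComb γ

namespace BTree

theorem one_le_arity (t : BTree) : 1 ≤ t.arity := by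
  induction t with
  | leaf => simp [arity]
  | node l r ihl ihr => simp only [arity]; omega

theorem multigraft_take (t : BTree) (n : ℕ) (rs : List BTree) (h : t.arity ≤ n) :
    t.multigraft (rs.take n) = t.multigraft rs := by
  induction t generalizing n rs with
  | leaf =>
    obtain ⟨m, rfl⟩ : ∃ m, n = m + 1 := ⟨n - 1, by simp only [arity] at h; omega⟩
    cases rs <;> simp [multigraft]
  | node l r ihl ihr =>
    simp only [arity] at h
    simp only [multigraft, List.take_take, List.drop_take, node.injEq]
    refine ⟨?_, ihr _ _ (by omega)⟩
    rw [Nat.min_eq_left (by omega)]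

theorem arity_multigraft (s : BTree) (qs : List BTree) (h : qs.length = s.arity) :
    (s.multigraft qs).arity = (qs.map arity).sum := by
  induction s generalizing qs with
  | leaf =>
    obtain ⟨q, rfl⟩ := List.length_eq_one_iff.1 h
    simp [multigraft]
  | node l r ihl ihr =>
    simp only [arity] at h
    simp only [multigraft, arity]
    rw [ihl _ (by simp; omega), ihr _ (by simp; omega), ← List.sum_append, ← List.map_append,
      List.take_append_drop]

/-- Grafting a forest onto a forest: the leaves of the trees of `qs`, read from left to right,
receive the successive elements of `vs`. -/
def forestGraft : List BTree → List BTree → List BTree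
  | [], _ => []
  | q :: qs, vs => q.multigraft vs :: forestGraft qs (vs.drop q.arity)

theorem length_forestGraft (qs vs : List BTree) : (forestGraft qs vs).length = qs.length := by
  induction qs generalizing vs with
  | nil => rfl
  | cons q qs ih => simp [forestGraft, ih]

theorem drop_forestGraft (n : ℕ) (qs vs : List BTree) :
    (forestGraft qs vs).drop n =
      forestGraft (qs.drop n) (vs.drop ((qs.take n).map arity).sum) := by
  induction n generalizing qs vs with
  | zero => simp
  | succ n ih =>
    cases qs with
    | nil => simp [forestGraft]
    | cons q qs => simp [forestGraft, ih, List.drop_drop]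

theorem take_forestGraft (n : ℕ) (qs vs : List BTree) :
    (forestGraft qs vs).take n = forestGraft (qs.take n) vs := by
  induction n generalizing qs vs with
  | zero => simp [forestGraft]
  | succ n ih =>
    cases qs with
    | nil => simp [forestGraft]
    | cons q qs => simp [forestGraft, ih]

theorem multigraft_multigraft (s : BTree) (qs vs : List BTree) (h : qs.length = s.arity) :
    (s.multigraft qs).multigraft vs = s.multigraft (forestGraft qs vs) := by
  induction s generalizing qs vs with
  | leaf =>
    obtain ⟨q, rfl⟩ := List.length_eq_one_iff.1 h
    simp [multigraft, forestGraft]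
  | node l r ihl ihr =>
    simp only [arity] at h
    have hl : (qs.take l.arity).length = l.arity := by simp; omega
    have hr : (qs.drop l.arity).length = r.arity := by simp; omega
    simp only [multigraft]
    rw [multigraft_take _ _ _ le_rfl, ihl _ _ hl, ihr _ _ hr, take_forestGraft, drop_forestGraft,
      arity_multigraft _ _ hl]

theorem multigraft_injective (s : BTree) {as bs : List BTree} (ha : as.length = s.arity)
    (hb : bs.length = s.arity) (h : s.multigraft as = s.multigraft bs) : as = bs := by
  induction s generalizing as bs with
  | leaf =>
    obtain ⟨a, rfl⟩ := List.length_eq_one_iff.1 ha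
    obtain ⟨b, rfl⟩ := List.length_eq_one_iff.1 hb
    simpa [multigraft] using h
  | node l r ihl ihr =>
    simp only [arity] at ha hb
    simp only [multigraft, node.injEq] at h
    rw [← List.take_append_drop l.arity as, ← List.take_append_drop l.arity bs,
      ihl (by simp; omega) (by simp; omega) h.1, ihr (by simp; omega) (by simp; omega) h.2]

theorem multigraft_node_append (l r : BTree) (as bs : List BTree) (ha : as.length = l.arity) :
    (node l r).multigraft (as ++ bs) = node (l.multigraft as) (r.multigraft bs) := by
  simp [multigraft, ← ha]

/-- `Prefix s t` means that `t` is obtained from `s` by grafting trees onto its leaves. -/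
def Prefix (s t : BTree) : Prop :=
  ∃ rs : List BTree, rs.length = s.arity ∧ t = s.multigraft rs

theorem Prefix.leaf (t : BTree) : Prefix leaf t := ⟨[t], rfl, rfl⟩

theorem Prefix.node {l l' r r' : BTree} (hl : Prefix l l') (hr : Prefix r r') :
    Prefix (node l r) (node l' r') := by
  obtain ⟨as, ha, rfl⟩ := hl
  obtain ⟨bs, hb, rfl⟩ := hr
  exact ⟨as ++ bs, by simp [arity, ha, hb], (multigraft_node_append _ _ _ _ ha).symm⟩

theorem Prefix.of_node {l r t : BTree} (h : Prefix (BTree.node l r) t) :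
    ∃ l' r', t = BTree.node l' r' ∧ Prefix l l' ∧ Prefix r r' := by
  obtain ⟨rs, hrs, rfl⟩ := h
  simp only [arity] at hrs
  exact ⟨_, _, rfl, ⟨_, by simp; omega, rfl⟩, ⟨_, by simp; omega, rfl⟩⟩

theorem Prefix.refl (t : BTree) : Prefix t t := by
  induction t with
  | leaf => exact .leaf _
  | node l r ihl ihr => exact ihl.node ihr

/-- The superposition of two trees at their roots. -/
def merge : BTree → BTree → BTree
  | leaf, p => p
  | node l r, leaf => node l r
  | node l r, node l' r' => node (merge l l') (merge r r')

theorem prefix_merge_left (s p : BTree) : Prefix s (merge s p) := by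
  induction s generalizing p with
  | leaf => exact .leaf _
  | node l r ihl ihr =>
    cases p with
    | leaf => exact .refl _
    | node l' r' => exact (ihl l').node (ihr r')

theorem prefix_merge_right (s p : BTree) : Prefix p (merge s p) := by
  induction s generalizing p with
  | leaf => exact .refl _
  | node l r ihl ihr =>
    cases p with
    | leaf => exact .leaf _
    | node l' r' => exact (ihl l').node (ihr r')

theorem Prefix.merge {s p t : BTree} (hs : Prefix s t) (hp : Prefix p t) :
    Prefix (merge s p) t := by
  induction s generalizing p t with
  | leaf => exact hp
  | node l r ihl ihr =>
    cases p with
    | leaf => exact hs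
    | node l' r' =>
      obtain ⟨a, b, rfl, ha, hb⟩ := hs.of_node
      obtain ⟨a', b', h, ha', hb'⟩ := hp.of_node
      obtain ⟨rfl, rfl⟩ := node.inj h
      exact (ihl ha ha').node (ihr hb hb')

theorem degree_merge_le (s p : BTree) : (merge s p).degree ≤ s.degree + p.degree := by
  induction s generalizing p with
  | leaf => simp [BTree.merge]
  | node l r ihl ihr =>
    cases p with
    | leaf => simp [BTree.merge]
    | node l' r' =>
      have := ihl l'
      have := ihr r'
      simp only [BTree.merge, degree]
      omega

theorem degree_merge_lt {s p : BTree} (hs : s ≠ leaf) (hp : p ≠ leaf) :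
    (merge s p).degree < s.degree + p.degree := by
  cases s with
  | leaf => exact absurd rfl hs
  | node l r =>
    cases p with
    | leaf => exact absurd rfl hp
    | node l' r' =>
      have := degree_merge_le l l'
      have := degree_merge_le r r'
      simp only [BTree.merge, degree]
      omega

end BTree

open BTree Relation

/-- The rewrite relation induced by `R`, presented by closure under contexts: a step either
rewrites at the root, or inside the left or the right subtree. -/
inductive ContextStep (R : BTree → BTree → Prop) : BTree → BTree → Prop
  | root {s s' : BTree} {rs : List BTree} : R s s' → rs.length = s.arity →
      ContextStep R (s.multigraft rs) (s'.multigraft rs)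
  | left {l l' : BTree} (r : BTree) : ContextStep R l l' →
      ContextStep R (.node l r) (.node l' r)
  | right (l : BTree) {r r' : BTree} : ContextStep R r r' →
      ContextStep R (.node l r) (.node l r')

section

variable {R : BTree → BTree → Prop}

theorem Step.contextStep {t t' : BTree} (h : Step R t t') : ContextStep R t t' := by
  obtain ⟨s, s', r, i, rs, hR, hi, hir, hlen, rfl, rfl⟩ := h
  induction r generalizing i with
  | leaf =>
    obtain rfl : i = 1 := by simp only [arity] at hir; omega
    simpa [graft] using ContextStep.root hR hlen
  | node a b iha ihb =>
    simp only [arity] at hir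
    simp only [graft]
    split_ifs with h
    · exact (iha i hi h).left _
    · exact (ihb (i - a.arity) (by omega) (by omega)).right _

theorem ContextStep.step {t t' : BTree} (h : ContextStep R t t') : Step R t t' := by
  induction h with
  | root hR hlen => exact ⟨_, _, .leaf, 1, _, hR, le_rfl, le_rfl, hlen, by simp [graft],
      by simp [graft]⟩
  | left r _ ih =>
    obtain ⟨s, s', c, i, rs, hR, hi, hic, hlen, rfl, rfl⟩ := ih
    exact ⟨s, s', .node c r, i, rs, hR, hi, by simp only [arity]; omega, hlen,
      by simp [graft, hic], by simp [graft, hic]⟩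
  | right l _ ih =>
    obtain ⟨s, s', c, i, rs, hR, hi, hic, hlen, rfl, rfl⟩ := ih
    have hn : ¬ i + l.arity ≤ l.arity := by omega
    exact ⟨s, s', .node l c, i + l.arity, rs, hR, by omega, by simp only [arity]; omega, hlen,
      by simp only [graft, if_neg hn, Nat.add_sub_cancel],
      by simp only [graft, if_neg hn, Nat.add_sub_cancel]⟩

theorem step_eq_contextStep : Step R = ContextStep R := by
  funext t t'
  exact propext ⟨Step.contextStep, ContextStep.step⟩

theorem ContextStep.arity_eq (harity : ∀ s s', R s s' → s.arity = s'.arity) {t t' : BTree}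
    (h : ContextStep R t t') : t.arity = t'.arity := by
  induction h with
  | root hR hlen =>
    rw [arity_multigraft _ _ hlen, arity_multigraft _ _ (hlen.trans (harity _ _ hR))]
  | left r _ ih => simp [arity, ih]
  | right l _ ih => simp [arity, ih]

theorem ContextStep.multigraft (harity : ∀ s s', R s s' → s.arity = s'.arity) {t t' : BTree}
    (h : ContextStep R t t') (vs : List BTree) :
    ContextStep R (t.multigraft vs) (t'.multigraft vs) := by
  induction h generalizing vs with
  | root hR hlen =>
    rw [multigraft_multigraft _ _ _ hlen,
      multigraft_multigraft _ _ _ (hlen.trans (harity _ _ hR))]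
    exact .root hR ((length_forestGraft _ _).trans hlen)
  | left r h ih =>
    simp only [BTree.multigraft, h.arity_eq harity]
    exact (ih _).left _
  | right l h ih =>
    simp only [BTree.multigraft]
    exact (ih _).right _

theorem reflTransGen_contextStep_node {l l' r r' : BTree}
    (hl : ReflTransGen (ContextStep R) l l') (hr : ReflTransGen (ContextStep R) r r') :
    ReflTransGen (ContextStep R) (.node l r) (.node l' r') :=
  (hl.lift (fun x => BTree.node x r) fun _ _ h => h.left r).trans
    (hr.lift (BTree.node l') fun _ _ h => h.right l')

theorem reflTransGen_contextStep_multigraft (s : BTree) {rs rs' : List BTree}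
    (h : List.Forall₂ (ReflTransGen (ContextStep R)) rs rs') :
    ReflTransGen (ContextStep R) (s.multigraft rs) (s.multigraft rs') := by
  induction s generalizing rs rs' with
  | leaf =>
    cases h with
    | nil => exact .refl
    | cons h _ => exact h
  | node l r ihl ihr =>
    exact reflTransGen_contextStep_node (ihl (List.forall₂_take _ h)) (ihr (List.forall₂_drop _ h))

/-- A step from an instance `s.multigraft rs` either takes place inside the grafted trees, or is
an instance of a step on a tree that extends `s` by fewer than `d` internal nodes. -/
theorem ContextStep.inside_or_overlap {d : ℕ}
    (harity : ∀ s s', R s s' → s.arity = s'.arity) (hdeg : ∀ s s', R s s' → s.degree ≤ d)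
    (hleaf : ∀ s s', R s s' → s ≠ .leaf) (s : BTree) {rs : List BTree}
    (hrs : rs.length = s.arity) {b : BTree} (h : ContextStep R (s.multigraft rs) b) :
    (∃ rs', List.Forall₂ (ReflTransGen (ContextStep R)) rs rs' ∧ b = s.multigraft rs') ∨
    ∃ u v vs, Prefix s u ∧ u.degree < s.degree + d ∧ ContextStep R u v ∧
      vs.length = u.arity ∧ s.multigraft rs = u.multigraft vs ∧ b = v.multigraft vs := by
  induction s generalizing rs b with
  | leaf =>
    obtain ⟨q, rfl⟩ := List.length_eq_one_iff.1 hrs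
    exact .inl ⟨[b], .cons (.single h) .nil, rfl⟩
  | node l r ihl ihr =>
    have hrs' := hrs
    simp only [arity] at hrs'
    have hl : (rs.take l.arity).length = l.arity := by simp; omega
    have hr : (rs.drop l.arity).length = r.arity := by simp; omega
    generalize ht : (BTree.node l r).multigraft rs = t at h
    cases h with
    | @root p p' qs hR hqs =>
      right
      have hle : Prefix (merge (.node l r) p) (p.multigraft qs) :=
        Prefix.merge ⟨rs, hrs, ht.symm⟩ ⟨qs, hqs, rfl⟩
      obtain ⟨vs, hvs, hvs'⟩ := hle
      obtain ⟨ps, hps, hu⟩ := prefix_merge_right (.node l r) p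
      refine ⟨_, p'.multigraft ps, vs, prefix_merge_left _ p, ?_, hu ▸ .root hR hps, hvs, hvs', ?_⟩
      · have := degree_merge_lt (s := .node l r) (by simp) (hleaf _ _ hR)
        have := hdeg _ _ hR
        omega
      · rw [hu, multigraft_multigraft _ _ _ hps] at hvs'
        rw [multigraft_multigraft _ _ _ (hps.trans (harity _ _ hR)),
          multigraft_injective p hqs ((length_forestGraft _ _).trans hps) hvs']
    | left r₀ h =>
      simp only [BTree.multigraft, BTree.node.injEq] at ht
      obtain ⟨rfl, rfl⟩ := ht
      obtain ⟨as, has, rfl⟩ | ⟨u, v, vs, hsu, hdu, huv, hvs, htu, rfl⟩ := ihl hl h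
      · refine .inl ⟨as ++ rs.drop l.arity, ?_, ?_⟩
        · conv => arg 2; rw [← List.take_append_drop l.arity rs]
          exact List.rel_append has (List.forall₂_same.2 fun _ _ => .refl)
        · rw [multigraft_node_append _ _ _ _ (has.length_eq.symm.trans hl)]
      · refine .inr ⟨.node u r, .node v r, vs ++ rs.drop l.arity, hsu.node (.refl r), ?_,
          huv.left r, ?_, ?_, ?_⟩
        · simp only [degree]; omega
        · simp only [List.length_append, hvs, hr, arity]
        · rw [multigraft_node_append _ _ _ _ hvs, ← htu]
        · rw [multigraft_node_append _ _ _ _ (hvs.trans (huv.arity_eq harity))]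
    | right l₀ h =>
      simp only [BTree.multigraft, BTree.node.injEq] at ht
      obtain ⟨rfl, rfl⟩ := ht
      obtain ⟨as, has, rfl⟩ | ⟨u, v, vs, hsu, hdu, huv, hvs, htu, rfl⟩ := ihr hr h
      · refine .inl ⟨rs.take l.arity ++ as, ?_, ?_⟩
        · conv => arg 2; rw [← List.take_append_drop l.arity rs]
          exact List.rel_append (List.forall₂_same.2 fun _ _ => .refl) has
        · rw [multigraft_node_append _ _ _ _ hl]
      · refine .inr ⟨.node l u, .node l v, rs.take l.arity ++ vs, (Prefix.refl l).node hsu, ?_,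
          huv.right l, ?_, ?_, ?_⟩
        · simp only [degree]; omega
        · simp only [List.length_append, hvs, hl, arity]
        · rw [multigraft_node_append _ _ _ _ hl, ← htu]
        · rw [multigraft_node_append _ _ _ _ hl]

theorem ContextStep.join_root {d : ℕ}
    (harity : ∀ s s', R s s' → s.arity = s'.arity) (hdeg : ∀ s s', R s s' → s.degree ≤ d)
    (hleaf : ∀ s s', R s s' → s ≠ .leaf)
    (hjoin : ∀ t s₁ s₂ : BTree, t.degree ≤ 2 * d - 1 → s₁ ≠ s₂ →
      ContextStep R t s₁ → ContextStep R t s₂ → Join (ReflTransGen (ContextStep R)) s₁ s₂)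
    {s s' b : BTree} {rs : List BTree} (hR : R s s') (hrs : rs.length = s.arity)
    (h : ContextStep R (s.multigraft rs) b) :
    Join (ReflTransGen (ContextStep R)) (s'.multigraft rs) b := by
  obtain ⟨rs', hrs', rfl⟩ | ⟨u, v, vs, ⟨qs, hqs, rfl⟩, hdu, huv, hvs, htu, rfl⟩ :=
    h.inside_or_overlap harity hdeg hleaf s hrs
  · exact ⟨_, reflTransGen_contextStep_multigraft s' hrs',
      .single (.root hR (hrs'.length_eq.symm.trans hrs))⟩
  · rw [multigraft_multigraft _ _ _ hqs] at htu
    obtain rfl := multigraft_injective s hrs ((length_forestGraft _ _).trans hqs) htu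
    rw [← multigraft_multigraft _ _ _ (hqs.trans (harity _ _ hR))]
    by_cases hne : s'.multigraft qs = v
    · exact hne ▸ ⟨_, .refl, .refl⟩
    · have := hdeg _ _ hR
      obtain ⟨w, hw, hw'⟩ := hjoin _ _ _ (by omega) hne (.root hR hqs) huv
      exact ⟨w.multigraft vs, hw.lift (fun x => x.multigraft vs) fun _ _ h => h.multigraft harity vs,
        hw'.lift (fun x => x.multigraft vs) fun _ _ h => h.multigraft harity vs⟩

theorem ContextStep.join_of_join_le_degree {d : ℕ}
    (harity : ∀ s s', R s s' → s.arity = s'.arity) (hdeg : ∀ s s', R s s' → s.degree ≤ d)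
    (hleaf : ∀ s s', R s s' → s ≠ .leaf)
    (hjoin : ∀ t s₁ s₂ : BTree, t.degree ≤ 2 * d - 1 → s₁ ≠ s₂ →
      ContextStep R t s₁ → ContextStep R t s₂ → Join (ReflTransGen (ContextStep R)) s₁ s₂)
    {t a b : BTree} (ha : ContextStep R t a) (hb : ContextStep R t b) :
    Join (ReflTransGen (ContextStep R)) a b := by
  induction ha generalizing b with
  | root hR hrs => exact hb.join_root harity hdeg hleaf hjoin hR hrs
  | @left l l' r h ih =>
    generalize ht : BTree.node l r = t at hb
    cases hb with
    | root hR hrs =>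
      exact Join.symm.symm _ _ ((ht ▸ h.left r).join_root harity hdeg hleaf hjoin hR hrs)
    | left _ h' =>
      obtain ⟨rfl, rfl⟩ := BTree.node.inj ht
      obtain ⟨c, hc, hc'⟩ := ih h'
      exact ⟨_, reflTransGen_contextStep_node hc .refl, reflTransGen_contextStep_node hc' .refl⟩
    | right _ h' =>
      obtain ⟨rfl, rfl⟩ := BTree.node.inj ht
      exact ⟨_, .single (h'.right _), .single (h.left _)⟩
  | @right l r r' h ih =>
    generalize ht : BTree.node l r = t at hb
    cases hb with
    | root hR hrs =>
      exact Join.symm.symm _ _ ((ht ▸ h.right l).join_root harity hdeg hleaf hjoin hR hrs)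
    | left _ h' =>
      obtain ⟨rfl, rfl⟩ := BTree.node.inj ht
      exact ⟨_, .single (h'.left _), .single (h.right _)⟩
    | right _ h' =>
      obtain ⟨rfl, rfl⟩ := BTree.node.inj ht
      obtain ⟨c, hc, hc'⟩ := ih h'
      exact ⟨_, reflTransGen_contextStep_node .refl hc, reflTransGen_contextStep_node .refl hc'⟩

/-- **Newman's lemma**: a terminating, locally confluent relation is confluent. -/
theorem Relation.join_of_wellFounded_of_locally_join {α : Type*} {r : α → α → Prop}
    (hwf : WellFounded (flip r))
    (hloc : ∀ a b c, r a b → r a c → Join (ReflTransGen r) b c) {a b c : α}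
    (hab : ReflTransGen r a b) (hac : ReflTransGen r a c) : Join (ReflTransGen r) b c := by
  induction a using hwf.induction generalizing b c with
  | _ a ih =>
    obtain rfl | ⟨b', hab', hb'b⟩ := hab.cases_head
    · exact ⟨c, hac, .refl⟩
    obtain rfl | ⟨c', hac', hc'c⟩ := hac.cases_head
    · exact ⟨b, .refl, hab⟩
    obtain ⟨e, hb'e, hc'e⟩ := hloc _ _ _ hab' hac'
    obtain ⟨f, hbf, hef⟩ := ih b' hab' hb'b hb'e
    obtain ⟨g, hfg, hcg⟩ := ih c' hac' (hc'e.trans hef) hc'c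
    exact ⟨g, hbf.trans hfg, hcg⟩

theorem Terminating.wellFounded (h : Terminating R) : WellFounded (flip (Step R)) :=
  wellFounded_iff_isEmpty_descending_chain.2 ⟨fun f => h ⟨f.1, f.2⟩⟩

/-- In a terminating system no rule rewrites a leaf, since by arity it would rewrite it to
itself. -/
theorem Terminating.ne_leaf (h : Terminating R)
    (harity : ∀ s s', R s s' → s.arity = s'.arity) {s s' : BTree} (hR : R s s') : s ≠ .leaf := by
  rintro rfl
  have hs' : s' = .leaf := by
    have := harity _ _ hR
    cases s' with
    | leaf => rfl
    | node l r =>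
      have := one_le_arity l
      have := one_le_arity r
      simp only [arity] at *
      omega
  subst hs'
  exact h ⟨fun _ => .leaf, fun _ => (ContextStep.root (rs := [.leaf]) hR rfl).step⟩

end

/-- Critical pair lemma: if all rules of `R` involve trees of degree at most `d`,
the induced rewrite relation is terminating, and all branching pairs of trees of
degree at most `2d - 1` are joinable, then the rewrite relation is confluent. -/
theorem stmt2 (R : BTree → BTree → Prop) (d : ℕ) (hd : 1 ≤ d)
    (harity : ∀ s s', R s s' → s.arity = s'.arity)
    (hdeg : ∀ s s', R s s' → s.degree ≤ d ∧ s'.degree ≤ d)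
    (hterm : Terminating R)
    (hjoin : ∀ t s₁ s₂ : BTree, t.degree ≤ 2 * d - 1 → s₁ ≠ s₂ →
      Step R t s₁ → Step R t s₂ →
      ∃ t', Relation.ReflTransGen (Step R) s₁ t' ∧ Relation.ReflTransGen (Step R) s₂ t') :
    Confluent R := by
  intro t s₁ s₂ h₁ h₂
  refine join_of_wellFounded_of_locally_join hterm.wellFounded ?_ h₁ h₂
  rw [step_eq_contextStep] at hjoin ⊢
  exact fun _ _ _ => ContextStep.join_of_join_le_degree harity (fun s s' h => (hdeg s s' h).1)
    (fun _ _ => hterm.ne_leaf harity) hjoin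
end

section
/- Let γ ≥ 2 and γ' ≥ 1 be integers. Then L_{γ'} ≡_γ R_{γ'} if and only if γ − 1 divides γ' − 1. (This is the combinatorial content of the statement that there exists an operad morphism from the γ'-comb associative operad CAs_{γ'} to CAs_γ if and only if (γ − 1) | (γ' − 1).) -/
namespace BTree

theorem arity_pos (t : BTree) : 0 < t.arity := by
  induction t with
  | leaf => simp [arity]
  | node l r ihl _ => simp only [arity]; omega

theorem arity_leftComb (n : ℕ) : (leftComb n).arity = n + 1 := by
  induction n with
  | zero => rfl
  | succ n ih => simp [leftComb, arity, ih]

theorem leftRank_leftComb (n : ℕ) : (leftComb n).leftRank = n := by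
  induction n with
  | zero => rfl
  | succ n ih => simp [leftComb, leftRank, ih]

theorem leftRank_rightComb_succ (n : ℕ) : (rightComb (n + 1)).leftRank = 1 := rfl

theorem leftRank_multigraft (s : BTree) (rs : List BTree) :
    (s.multigraft rs).leftRank = s.leftRank + (rs.headD leaf).leftRank := by
  induction s generalizing rs with
  | leaf => simp [multigraft, leftRank]
  | node l r ihl _ =>
    have hhead : (rs.take l.arity).headD leaf = rs.headD leaf := by
      obtain ⟨m, hm⟩ := Nat.exists_eq_succ_of_ne_zero l.arity_pos.ne'
      cases rs <;> simp [hm]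
    simp only [multigraft, leftRank, ihl, hhead]
    omega

theorem leftRank_graft_modEq {d : ℕ} {a b : BTree} (h : a.leftRank ≡ b.leftRank [MOD d])
    (r : BTree) (i : ℕ) : (r.graft i a).leftRank ≡ (r.graft i b).leftRank [MOD d] := by
  induction r generalizing i with
  | leaf =>
    simp only [graft]
    split_ifs
    · exact h
    · rfl
  | node l r ihl _ =>
    simp only [graft]
    split_ifs
    · exact (ihl i).add_right 1
    · rfl

/-- The left comb with `n` internal nodes whose leftmost leaf is replaced by `x`. -/
def leftCombOver (x : BTree) : ℕ → BTree
  | 0 => x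
  | n + 1 => node (leftCombOver x n) leaf

/-- The right comb with `n` internal nodes whose rightmost leaf is replaced by `y`. -/
def rightCombOver (y : BTree) : ℕ → BTree
  | 0 => y
  | n + 1 => node leaf (rightCombOver y n)

theorem multigraft_leftComb (x : BTree) (n : ℕ) :
    (leftComb n).multigraft (x :: List.replicate n leaf) = leftCombOver x n := by
  induction n with
  | zero => rfl
  | succ n ih =>
    simp [leftComb, multigraft, arity_leftComb, leftCombOver, ih, List.take_replicate,
      List.drop_replicate]

theorem multigraft_rightComb (y : BTree) (n : ℕ) :
    (rightComb n).multigraft (List.replicate n leaf ++ [y]) = rightCombOver y n := by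
  induction n with
  | zero => rfl
  | succ n ih => simp [rightComb, multigraft, arity, rightCombOver, ih, List.replicate_succ]

theorem leftCombOver_leftComb (m n : ℕ) :
    leftCombOver (leftComb m) n = leftComb (m + n) := by
  induction n with
  | zero => rfl
  | succ n ih => simp [leftCombOver, ih, leftComb]

theorem rightCombOver_rightComb (m n : ℕ) :
    rightCombOver (rightComb m) n = rightComb (m + n) := by
  induction n with
  | zero => rfl
  | succ n ih => simp [rightCombOver, ih, rightComb]

end BTree

open BTree

theorem CAsCongr.leftRank_modEq {d : ℕ} {t t' : BTree} (h : CAsCongr (d + 1) t t') :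
    t.leftRank ≡ t'.leftRank [MOD d] := by
  induction h with
  | rel _ _ h =>
    obtain ⟨_, _, r, i, rs, ⟨rfl, rfl⟩, _, _, _, rfl, rfl⟩ := h
    refine leftRank_graft_modEq ?_ r i
    rw [leftRank_multigraft, leftRank_multigraft, leftRank_leftComb, leftRank_rightComb_succ]
    exact Nat.ModEq.add_right _ (by simp [Nat.ModEq])
  | refl => rfl
  | symm _ _ _ ih => exact ih.symm
  | trans _ _ _ _ _ ih₁ ih₂ => exact ih₁.trans ih₂

theorem CAsCongr.node_leftCombOver (d : ℕ) (x y : BTree) :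
    CAsCongr (d + 1) (node (leftCombOver x d) y) (node x (rightCombOver y d)) := by
  refine .rel _ _ ⟨_, _, leaf, 1, x :: List.replicate d leaf ++ [y], ⟨rfl, rfl⟩, le_rfl, le_rfl,
    by simp [arity_leftComb], ?_, ?_⟩
  · simp [graft, leftComb, multigraft, arity_leftComb, ← multigraft_leftComb]
  · simp [graft, rightComb, multigraft, arity, ← multigraft_rightComb]

theorem CAsCongr.node_leftComb_mul (d k m : ℕ) :
    CAsCongr (d + 1) (node (leftComb (d * k)) (rightComb m)) (rightComb (m + d * k + 1)) := by
  induction k generalizing m with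
  | zero => exact .refl _
  | succ k ih =>
    have h := CAsCongr.node_leftCombOver d (leftComb (d * k)) (rightComb m)
    rw [leftCombOver_leftComb, rightCombOver_rightComb] at h
    have hk := h.trans _ _ _ (ih (m + d))
    rwa [show m + d + d * k = m + d * (k + 1) by ring] at hk

/-- `L_{γ'} ≡_γ R_{γ'}` if and only if `γ - 1` divides `γ' - 1`. -/
theorem stmt6 (γ γ' : ℕ) (hγ : 2 ≤ γ) (hγ' : 1 ≤ γ') :
    CAsCongr γ (BTree.leftComb γ') (BTree.rightComb γ') ↔ (γ - 1) ∣ (γ' - 1) := by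
  obtain ⟨d, rfl⟩ := Nat.exists_eq_add_of_le' (Nat.le_of_succ_le hγ)
  obtain ⟨n, rfl⟩ := Nat.exists_eq_add_of_le' hγ'
  simp only [Nat.add_sub_cancel]
  constructor
  · intro h
    have h := h.leftRank_modEq
    rw [leftRank_leftComb, leftRank_rightComb_succ] at h
    simpa using (Nat.modEq_iff_dvd' (Nat.le_add_left 1 n)).mp h.symm
  · rintro ⟨k, rfl⟩
    simpa [leftComb, rightComb] using CAsCongr.node_leftComb_mul d k 0
end
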